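/- Let β > 0 and λ ∈ ℂ with λ ≠ 0, and set Λ := Γ(1/3)/3^{2/3} = ∫₀^∞ e^{−y³/3} dy. Suppose g : {−1,1} × [0,∞) → ℂ is differentiable in y, with g(σ,·), y ↦ y·g(σ,y) and y ↦ y²·g(σ,y) integrable on [0,∞) for σ = ±1, and that g satisfies the eigen-system: (i) ∂g/∂y(σ,y) + y²·g(σ,y) + λ·g(σ,y) = (3/(2Λ))·βσk·y²·e^{−y³/3} for all y ≥ 0 and σ ∈ {−1,1}, where k := 2∫₀^∞ g(1,y) dy; (ii) g(σ,0) = (3/(2Λ))·βσk + ∫₀^∞ y²·g(−σ,y) dy for σ ∈ {−1,1}; (iii) ∫₀^∞ (g(1,y) + g(−1,y)) dy = 0. If k ≠ 0 and g(1,0) ≠ 0, then H_{β,2}(λ) = 0, where H_{β,2}(λ) := H₂(λ)·[12β − λ⁴Λ + 6βλΛ − 6βλ·3^{1/3}·Γ(4/3) + 3βλ²·3^{2/3}·Γ(5/3) − 6βλ²·3^{−1/3}·Γ(2/3)] + 2Λλ³ − 12βΛ + 12β·3^{−1/3}·Γ(2/3)·λ − 6βλ², and H₂(λ) := ∫₀^∞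 e^{−y³/3} e^{−λy} dy. -/

import Mathlib

open MeasureTheory Set

/-- `H₂(λ) = ∫₀^∞ e^{-y³/3} e^{-λy} dy`. -/
noncomputable def H2 (l : ℂ) : ℂ :=
  ∫ y in Ioi (0:ℝ), Complex.exp (-(y:ℂ)^3 / 3) * Complex.exp (-(l * y))

/-- The moments of `e^{-y³/3}` on the half-line, as an integrability statement. -/
theorem integrableOn_pow_mul_cexp_neg_cube (n : ℕ) :
    IntegrableOn (fun y : ℝ => (y:ℂ)^n * Complex.exp (-(y:ℂ)^3 / 3)) (Ioi 0) := by
  have h := (integrableOn_rpow_mul_exp_neg_mul_rpow (p := 3) (s := n) (b := 1/3)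
    (by have : (0:ℝ) ≤ n := n.cast_nonneg
        linarith) (by norm_num) (by norm_num)).ofReal (𝕜 := ℂ)
  refine IntegrableOn.congr_fun h (fun y _ => ?_) measurableSet_Ioi
  have h3 : y ^ (3:ℝ) = y ^ 3 := by exact_mod_cast Real.rpow_natCast y 3
  simp only [Real.rpow_natCast, h3, RCLike.ofReal_eq_complex_ofReal]
  push_cast
  ring_nf

/-- The moments of `e^{-y³/3}` on the half-line in terms of the Gamma function. -/
theorem integral_pow_mul_cexp_neg_cube (n : ℕ) :
    ∫ y in Ioi (0:ℝ), (y:ℂ)^n * Complex.exp (-(y:ℂ)^3 / 3)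
      = (((3:ℝ) ^ (((n:ℝ) + 1) / 3) * (1 / 3) * Real.Gamma (((n:ℝ) + 1) / 3) : ℝ) : ℂ) := by
  have h := integral_rpow_mul_exp_neg_mul_rpow (p := 3) (q := n) (b := 1/3) (by norm_num)
    (by have : (0:ℝ) ≤ n := n.cast_nonneg
        linarith) (by norm_num)
  have hb : ((1:ℝ) / 3) ^ (-(((n:ℝ) + 1) / 3)) = (3:ℝ) ^ (((n:ℝ) + 1) / 3) := by
    rw [one_div, Real.inv_rpow (by norm_num), Real.rpow_neg (by norm_num), inv_inv]
  rw [neg_div, hb] at h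
  rw [← h, ← integral_complex_ofReal]
  refine setIntegral_congr_fun measurableSet_Ioi (fun y _ => ?_)
  have h3 : y ^ (3:ℝ) = y ^ 3 := by exact_mod_cast Real.rpow_natCast y 3
  simp only [Real.rpow_natCast, h3]
  push_cast
  ring_nf

/-- Integrated form of `u' + y² u + l u = c y² e^{-y³/3}` on the half-line. -/
theorem integral_sq_mul_add_of_ode {u u' : ℝ → ℂ} {l c : ℂ}
    (hd : ∀ y : ℝ, 0 ≤ y → HasDerivWithinAt u (u' y) (Ici 0) y)
    (hi : IntegrableOn u (Ioi 0))
    (hi₂ : IntegrableOn (fun y : ℝ => (y:ℂ)^2 * u y) (Ioi 0))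
    (hode : ∀ y : ℝ, 0 ≤ y →
      u' y + (y:ℂ)^2 * u y + l * u y = c * ((y:ℂ)^2 * Complex.exp (-(y:ℂ)^3 / 3))) :
    (∫ y in Ioi (0:ℝ), (y:ℂ)^2 * u y) + l * (∫ y in Ioi (0:ℝ), u y) = c + u 0 := by
  have hm := (integrableOn_pow_mul_cexp_neg_cube 2).const_mul c
  have hm2 : ∫ y in Ioi (0:ℝ), (y:ℂ)^2 * Complex.exp (-(y:ℂ)^3 / 3) = 1 := by
    rw [integral_pow_mul_cexp_neg_cube]
    norm_num
  have hlu := hi.const_mul l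
  have hu' : IntegrableOn u' (Ioi 0) := by
    refine IntegrableOn.congr_fun ((hm.sub hi₂).sub hlu) (fun y hy => ?_) measurableSet_Ioi
    have := hode y (le_of_lt hy)
    simp only [Pi.sub_apply]
    linear_combination -this
  have hd' : ∀ y ∈ Ioi (0:ℝ), HasDerivAt u (u' y) y := fun y hy =>
    (hd y (le_of_lt hy)).hasDerivAt (Ici_mem_nhds hy)
  have hlim := tendsto_zero_of_hasDerivAt_of_integrableOn_Ioi hd' hu' hi
  have hFTC := integral_Ioi_of_hasDerivAt_of_tendsto (hd 0 le_rfl).continuousWithinAt hd' hu' hlim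
  have hcongr : ∫ y in Ioi (0:ℝ), u' y
      = ∫ y in Ioi (0:ℝ), (c * ((y:ℂ)^2 * Complex.exp (-(y:ℂ)^3 / 3)) - (y:ℂ)^2 * u y - l * u y) := by
    refine setIntegral_congr_fun measurableSet_Ioi (fun y hy => ?_)
    have := hode y (le_of_lt hy)
    linear_combination this
  have hs : IntegrableOn (fun y : ℝ =>
    c * ((y:ℂ)^2 * Complex.exp (-(y:ℂ)^3 / 3)) - (y:ℂ)^2 * u y) (Ioi 0) := hm.sub hi₂
  rw [integral_sub hs hlu, integral_sub hm hi₂, integral_const_mul, integral_const_mul,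
    hm2, hFTC] at hcongr
  linear_combination hcongr

/-- Explicit solution of `u' + y² u + l u = c y² e^{-y³/3}` on the half-line. -/
theorem eq_of_ode {u u' : ℝ → ℂ} {l c : ℂ} (hl : l ≠ 0)
    (hd : ∀ y : ℝ, 0 ≤ y → HasDerivWithinAt u (u' y) (Ici 0) y)
    (hode : ∀ y : ℝ, 0 ≤ y →
      u' y + (y:ℂ)^2 * u y + l * u y = c * ((y:ℂ)^2 * Complex.exp (-(y:ℂ)^3 / 3)))
    {y : ℝ} (hy : 0 ≤ y) :
    u y = (u 0 - 2 * c / l^3) * (Complex.exp (-(y:ℂ)^3 / 3) * Complex.exp (-(l * y)))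
      + c * ((y:ℂ)^2 / l - 2 * y / l^2 + 2 / l^3) * Complex.exp (-(y:ℂ)^3 / 3) := by
  set w : ℝ → ℂ := fun y => u y * Complex.exp ((y:ℂ)^3 / 3 + l * y)
    - c * (((y:ℂ)^2 / l - 2 * y / l^2 + 2 / l^3) * Complex.exp (l * y)) with hw
  have hwd : ∀ x : ℝ, 0 ≤ x → HasDerivWithinAt w 0 (Ici 0) x := by
    intro x hx
    have h1 : HasDerivAt (fun y : ℂ => Complex.exp (y^3 / 3 + l * y))
        (Complex.exp ((x:ℂ)^3 / 3 + l * x) * ((x:ℂ)^2 + l)) x := by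
      have h : HasDerivAt (fun y : ℂ => Complex.exp (y^3 / 3 + l * y)) _ (x:ℂ) :=
        (((hasDerivAt_pow 3 (x:ℂ)).div_const 3).add ((hasDerivAt_id' (x:ℂ)).const_mul l)).cexp
      refine h.congr_deriv ?_
      simp only [Pi.add_apply]
      push_cast
      ring
    have h2 : HasDerivAt (fun y : ℂ => (y^2 / l - 2 * y / l^2 + 2 / l^3) * Complex.exp (l * y))
        ((x:ℂ)^2 * Complex.exp (l * x)) x := by
      have h : HasDerivAt (fun y : ℂ => (y^2 / l - 2 * y / l^2 + 2 / l^3) * Complex.exp (l * y))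
          _ (x:ℂ) :=
        ((((hasDerivAt_pow 2 (x:ℂ)).div_const l).sub
          (((hasDerivAt_id' (x:ℂ)).const_mul 2).div_const (l^2))).add_const (2 / l^3)).mul
          ((hasDerivAt_id' (x:ℂ)).const_mul l).cexp
      refine h.congr_deriv ?_
      simp only [Pi.sub_apply]
      push_cast
      field_simp
      ring
    have h3 := ((hd x hx).mul h1.comp_ofReal.hasDerivWithinAt).sub
      (h2.comp_ofReal.hasDerivWithinAt.const_mul c)
    refine h3.congr_deriv ?_
    have he : Complex.exp (-(x:ℂ)^3 / 3) * Complex.exp ((x:ℂ)^3 / 3 + l * x)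
        = Complex.exp (l * x) := by
      rw [← Complex.exp_add]
      congr 1
      ring
    linear_combination Complex.exp ((x:ℂ)^3 / 3 + l * x) * hode x hx + c * (x:ℂ)^2 * he
  have hconst : w y = w 0 := by
    refine (convex_Ici (0:ℝ)).is_const_of_fderivWithin_eq_zero (𝕜 := ℝ) (f := w)
      (fun x hx => (hwd x hx).differentiableWithinAt) (fun x hx => ?_) hy self_mem_Ici
    have := (hwd x hx).hasFDerivWithinAt.fderivWithin (uniqueDiffOn_Ici (0:ℝ) x hx)
    rw [this]
    ext
    simp
  have he1 : Complex.exp ((y:ℂ)^3 / 3 + l * y)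
      * (Complex.exp (-(y:ℂ)^3 / 3) * Complex.exp (-(l * y))) = 1 := by
    rw [← Complex.exp_add, ← Complex.exp_add, ← Complex.exp_zero]
    congr 1
    ring
  have he2 : Complex.exp (l * y) * Complex.exp (-(l * y)) = 1 := by
    rw [← Complex.exp_add, ← Complex.exp_zero]
    congr 1
    ring
  have hw0 : w 0 = u 0 - 2 * c / l^3 := by
    simp [hw]
    ring
  rw [hw0] at hconst
  simp only [hw] at hconst
  linear_combination (Complex.exp (-(y:ℂ)^3 / 3) * Complex.exp (-(l * y))) * hconst
    - u y * he1 + c * ((y:ℂ)^2 / l - 2 * y / l^2 + 2 / l^3) * Complex.exp (-(y:ℂ)^3 / 3) * he2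

/-- The total mass of a solution of `u' + y² u + l u = c y² e^{-y³/3}`. -/
theorem integral_of_ode {u u' : ℝ → ℂ} {l c : ℂ} (hl : l ≠ 0)
    (hd : ∀ y : ℝ, 0 ≤ y → HasDerivWithinAt u (u' y) (Ici 0) y)
    (hi : IntegrableOn u (Ioi 0))
    (hode : ∀ y : ℝ, 0 ≤ y →
      u' y + (y:ℂ)^2 * u y + l * u y = c * ((y:ℂ)^2 * Complex.exp (-(y:ℂ)^3 / 3))) :
    l^3 * (∫ y in Ioi (0:ℝ), u y) = (l^3 * u 0 - 2 * c) * H2 l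
      + c * (l^2 - 2 * l * (∫ y in Ioi (0:ℝ), (y:ℂ)^1 * Complex.exp (-(y:ℂ)^3 / 3))
        + 2 * ∫ y in Ioi (0:ℝ), (y:ℂ)^0 * Complex.exp (-(y:ℂ)^3 / 3)) := by
  have m0 := (integrableOn_pow_mul_cexp_neg_cube 0).const_mul (2 * c / l^3)
  have m1 := (integrableOn_pow_mul_cexp_neg_cube 1).const_mul (2 * c / l^2)
  have m2 := (integrableOn_pow_mul_cexp_neg_cube 2).const_mul (c / l)
  have hm2 : ∫ y in Ioi (0:ℝ), (y:ℂ)^2 * Complex.exp (-(y:ℂ)^3 / 3) = 1 := by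
    rw [integral_pow_mul_cexp_neg_cube]
    norm_num
  have hH : (u 0 - 2 * c / l^3) * H2 l
      = ∫ y in Ioi (0:ℝ), (u y - c / l * ((y:ℂ)^2 * Complex.exp (-(y:ℂ)^3 / 3))
        + 2 * c / l^2 * ((y:ℂ)^1 * Complex.exp (-(y:ℂ)^3 / 3))
        - 2 * c / l^3 * ((y:ℂ)^0 * Complex.exp (-(y:ℂ)^3 / 3))) := by
    rw [H2, ← integral_const_mul]
    refine setIntegral_congr_fun measurableSet_Ioi (fun y hy => ?_)
    have := eq_of_ode hl hd hode (le_of_lt hy)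
    linear_combination -this
  have hs : IntegrableOn (fun y : ℝ =>
    u y - c / l * ((y:ℂ)^2 * Complex.exp (-(y:ℂ)^3 / 3))) (Ioi 0) := hi.sub m2
  have hs' : IntegrableOn (fun y : ℝ => u y - c / l * ((y:ℂ)^2 * Complex.exp (-(y:ℂ)^3 / 3))
    + 2 * c / l^2 * ((y:ℂ)^1 * Complex.exp (-(y:ℂ)^3 / 3))) (Ioi 0) := hs.add m1
  rw [integral_sub hs' m0, integral_add hs m1, integral_sub hi m2,
    integral_const_mul, integral_const_mul, integral_const_mul, hm2] at hH
  generalize (∫ y in Ioi (0:ℝ), (y:ℂ)^1 * Complex.exp (-(y:ℂ)^3 / 3)) = M₁ at hH ⊢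
  generalize (∫ y in Ioi (0:ℝ), (y:ℂ)^0 * Complex.exp (-(y:ℂ)^3 / 3)) = M₀ at hH ⊢
  field_simp at hH
  linear_combination -hH

/-- any nontrivial solution of the linearized eigen-system for γ = 2
forces `H_{β,2}(λ) = 0`. -/
theorem stmt_2 (β : ℝ) (hβ : 0 < β) (l : ℂ) (hl : l ≠ 0)
    (Λ : ℝ) (hΛdef : Λ = Real.Gamma (1/3) / (3:ℝ) ^ ((2:ℝ)/3))
    (hΛint : Λ = ∫ y in Ioi (0:ℝ), Real.exp (-(y^3) / 3))
    (g : ℝ → ℝ → ℂ) (g' : ℝ → ℝ → ℂ) (k : ℂ)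
    (hk : k = 2 * ∫ y in Ioi (0:ℝ), g 1 y)
    (hderiv : ∀ σ ∈ ({-1, 1} : Set ℝ), ∀ y : ℝ, 0 ≤ y →
      HasDerivWithinAt (g σ) (g' σ y) (Ici 0) y)
    (hint₁ : ∀ σ ∈ ({-1, 1} : Set ℝ), IntegrableOn (g σ) (Ioi 0))
    (hint₂ : ∀ σ ∈ ({-1, 1} : Set ℝ), IntegrableOn (fun y : ℝ => (y:ℂ) * g σ y) (Ioi 0))
    (hint₃ : ∀ σ ∈ ({-1, 1} : Set ℝ), IntegrableOn (fun y : ℝ => (y:ℂ)^2 * g σ y) (Ioi 0))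
    (heq : ∀ σ ∈ ({-1, 1} : Set ℝ), ∀ y : ℝ, 0 ≤ y →
      g' σ y + (y:ℂ)^2 * g σ y + l * g σ y
        = (3 / (2 * (Λ:ℂ))) * (β:ℂ) * (σ:ℂ) * k * (y:ℂ)^2
            * Complex.exp (-(y:ℂ)^3 / 3))
    (hbdry : ∀ σ ∈ ({-1, 1} : Set ℝ),
      g σ 0 = (3 / (2 * (Λ:ℂ))) * (β:ℂ) * (σ:ℂ) * k
        + ∫ y in Ioi (0:ℝ), (y:ℂ)^2 * g (-σ) y)
    (hzero : (∫ y in Ioi (0:ℝ), (g 1 y + g (-1) y)) = 0)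
    (hk0 : k ≠ 0) (hg10 : g 1 0 ≠ 0) :
    H2 l * (12 * (β:ℂ) - l^4 * (Λ:ℂ) + 6 * (β:ℂ) * l * (Λ:ℂ)
        - 6 * (β:ℂ) * l * ((3:ℝ) ^ ((1:ℝ)/3) : ℝ) * (Real.Gamma (4/3) : ℂ)
        + 3 * (β:ℂ) * l^2 * ((3:ℝ) ^ ((2:ℝ)/3) : ℝ) * (Real.Gamma (5/3) : ℂ)
        - 6 * (β:ℂ) * l^2 * ((3:ℝ) ^ (-(1:ℝ)/3) : ℝ) * (Real.Gamma (2/3) : ℂ))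
      + 2 * (Λ:ℂ) * l^3 - 12 * (β:ℂ) * (Λ:ℂ)
      + 12 * (β:ℂ) * ((3:ℝ) ^ (-(1:ℝ)/3) : ℝ) * (Real.Gamma (2/3) : ℂ) * l
      - 6 * (β:ℂ) * l^2 = 0 := by
  have hp : (1:ℝ) ∈ ({-1, 1} : Set ℝ) := by simp
  have hm : (-1:ℝ) ∈ ({-1, 1} : Set ℝ) := by simp
  have hΛ0 : (Λ:ℂ) ≠ 0 := by
    have : 0 < Λ := by
      rw [hΛdef]
      exact div_pos (Real.Gamma_pos_of_pos (by norm_num)) (by positivity)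
    exact_mod_cast this.ne'
  have hM0 : ∫ y in Ioi (0:ℝ), (y:ℂ)^0 * Complex.exp (-(y:ℂ)^3 / 3) = (Λ:ℂ) := by
    rw [hΛint, ← integral_complex_ofReal]
    refine setIntegral_congr_fun measurableSet_Ioi (fun y _ => ?_)
    simp
  have r1 : (3:ℝ) ^ ((2:ℝ)/3) = 3 * (3:ℝ) ^ (-(1:ℝ)/3) := by
    have := Real.rpow_add (x := 3) (by norm_num) 1 (-(1:ℝ)/3)
    rw [Real.rpow_one] at this
    rw [← this]
    norm_num
  have r2 : (3:ℝ) ^ ((1:ℝ)/3) * (3:ℝ) ^ ((2:ℝ)/3) = 3 := by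
    rw [← Real.rpow_add (by norm_num)]
    norm_num
  have hM1 : ∫ y in Ioi (0:ℝ), (y:ℂ)^1 * Complex.exp (-(y:ℂ)^3 / 3)
      = (((3:ℝ) ^ (-(1:ℝ)/3) : ℝ) : ℂ) * (Real.Gamma (2/3) : ℂ) := by
    rw [integral_pow_mul_cexp_neg_cube, ← Complex.ofReal_mul]
    congr 1
    have : (((1:ℕ):ℝ) + 1) / 3 = 2 / 3 := by norm_num
    rw [this, r1]
    ring
  have hG4 : (((3:ℝ) ^ ((1:ℝ)/3) : ℝ) : ℂ) * (Real.Gamma (4/3) : ℂ) = Λ := by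
    rw [← Complex.ofReal_mul]
    congr 1
    have h := Real.Gamma_add_one (s := 1/3) (by norm_num)
    have h43 : (1:ℝ)/3 + 1 = 4/3 := by norm_num
    rw [h43] at h
    rw [hΛdef, h, eq_div_iff (by positivity)]
    linear_combination (1/3 * Real.Gamma (1/3)) * r2
  have hG5 : (((3:ℝ) ^ ((2:ℝ)/3) : ℝ) : ℂ) * (Real.Gamma (5/3) : ℂ)
      = 2 * ((((3:ℝ) ^ (-(1:ℝ)/3) : ℝ) : ℂ) * (Real.Gamma (2/3) : ℂ)) := by
    have h := Real.Gamma_add_one (s := 2/3) (by norm_num)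
    have h53 : (2:ℝ)/3 + 1 = 5/3 := by norm_num
    rw [h53] at h
    rw [r1, h]
    push_cast
    ring
  -- the antisymmetric part of `g` solves a closed scalar problem
  set c : ℂ := (3 / (2 * (Λ:ℂ))) * (β:ℂ) * k with hc
  set u : ℝ → ℂ := fun y => (1/2) * (g 1 y - g (-1) y) with hu
  have hd : ∀ y : ℝ, 0 ≤ y →
      HasDerivWithinAt u ((1/2) * (g' 1 y - g' (-1) y)) (Ici 0) y := fun y hy =>
    ((hderiv 1 hp y hy).sub (hderiv (-1) hm y hy)).const_mul _
  have hode : ∀ y : ℝ, 0 ≤ y → (1/2) * (g' 1 y - g' (-1) y) + (y:ℂ)^2 * u y + l * u y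
      = c * ((y:ℂ)^2 * Complex.exp (-(y:ℂ)^3 / 3)) := by
    intro y hy
    have h1 := heq 1 hp y hy
    have h2 := heq (-1) hm y hy
    push_cast at h1 h2
    simp only [hu, hc]
    linear_combination (1/2) * h1 - (1/2) * h2
  have hi : IntegrableOn u (Ioi 0) := ((hint₁ 1 hp).sub (hint₁ (-1) hm)).const_mul _
  have hsq : (fun y : ℝ => (y:ℂ)^2 * u y)
      = fun y : ℝ => (1/2) * ((y:ℂ)^2 * g 1 y - (y:ℂ)^2 * g (-1) y) := by
    funext y
    simp only [hu]
    ring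
  have hi₂ : IntegrableOn (fun y : ℝ => (y:ℂ)^2 * u y) (Ioi 0) := by
    rw [hsq]
    exact ((hint₃ 1 hp).sub (hint₃ (-1) hm)).const_mul _
  have hIu : ∫ y in Ioi (0:ℝ), u y = k / 2 := by
    rw [integral_add (hint₁ 1 hp) (hint₁ (-1) hm)] at hzero
    simp only [hu]
    rw [integral_const_mul, integral_sub (hint₁ 1 hp) (hint₁ (-1) hm), hk]
    linear_combination (-1/2) * hzero
  have hu0 : u 0 = c - ∫ y in Ioi (0:ℝ), (y:ℂ)^2 * u y := by
    have h1 := hbdry 1 hp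
    have h2 := hbdry (-1) hm
    rw [neg_neg] at h2
    push_cast at h1 h2
    rw [hsq, integral_const_mul, integral_sub (hint₃ 1 hp) (hint₃ (-1) hm)]
    simp only [hu, hc]
    linear_combination (1/2) * h1 - (1/2) * h2
  have hA := integral_sq_mul_add_of_ode hd hi hi₂ hode
  have hB := integral_of_ode hl hd hi hode
  rw [hIu] at hA hB
  rw [hM0, hM1] at hB
  have hu0' : u 0 = l * k / 4 := by linear_combination (1/2) * hu0 - (1/2) * hA
  have hcΛ : 2 * Λ * c = 3 * β * k := by
    rw [hc]
    field_simp
  rw [hu0'] at hB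
  refine mul_left_cancel₀ hk0 ?_
  linear_combination (4 * (Λ:ℂ)) * hB
    + (-4 * H2 l + 2 * (l^2 - 2 * l * ((((3:ℝ) ^ (-(1:ℝ)/3) : ℝ) : ℂ) * (Real.Gamma (2/3) : ℂ))
        + 2 * Λ)) * hcΛ
    - 6 * k * β * l * H2 l * hG4 + 3 * k * β * l^2 * H2 l * hG5
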